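/- arXiv:1912.06599 — 9 statements merged into one kernel-verified Lean document; each statement's English description precedes it below -/
import Mathlib

section
/- Let k ∈ (0,1) and let ψ : ℝ → ℝ be twice differentiable with ψ''(x) = (2 − k²)ψ(x) − 2ψ(x)³ for all x ∈ ℝ, ψ(0) = 1 and ψ'(0) = 0. Then √(1 − k²) ≤ ψ(x) ≤ 1 for all x ∈ ℝ. -/
/-- Conservation of energy for the differential equation of the Jacobi function `dn`. -/
theorem dn_deriv_sq {k : ℝ} {ψ : ℝ → ℝ} (hψ : Differentiable ℝ ψ)
    (hψ' : Differentiable ℝ (deriv ψ))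
    (hode : ∀ x, deriv (deriv ψ) x = (2 - k ^ 2) * ψ x - 2 * (ψ x) ^ 3)
    (hψ0 : ψ 0 = 1) (hψ'0 : deriv ψ 0 = 0) (x : ℝ) :
    deriv ψ x ^ 2 = (1 - ψ x ^ 2) * (ψ x ^ 2 - (1 - k ^ 2)) := by
  have hE : ∀ y, HasDerivAt
      (fun y => deriv ψ y ^ 2 - (2 - k ^ 2) * ψ y ^ 2 + ψ y ^ 4) 0 y := fun y => by
    refine ((((hψ' y).hasDerivAt.pow 2).sub (((hψ y).hasDerivAt.pow 2).const_mul
      (2 - k ^ 2))).add ((hψ y).hasDerivAt.pow 4)).congr_deriv ?_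
    rw [hode]
    push_cast
    ring
  have h := is_const_of_deriv_eq_zero (fun y => (hE y).differentiableAt)
    (fun y => (hE y).deriv) x 0
  simp only [hψ0, hψ'0] at h
  linear_combination h

theorem dn_bounds (k : ℝ) (hk : k ∈ Set.Ioo (0:ℝ) 1)
    (ψ : ℝ → ℝ) (hψ : Differentiable ℝ ψ) (hψ' : Differentiable ℝ (deriv ψ))
    (hode : ∀ x, deriv (deriv ψ) x = (2 - k ^ 2) * ψ x - 2 * (ψ x) ^ 3)
    (hψ0 : ψ 0 = 1) (hψ'0 : deriv ψ 0 = 0) :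
    ∀ x, Real.sqrt (1 - k ^ 2) ≤ ψ x ∧ ψ x ≤ 1 := by
  obtain ⟨hk0, hk1⟩ := hk
  have hc : 0 < 1 - k ^ 2 := by nlinarith
  have hprod : ∀ x, 0 ≤ (1 - ψ x ^ 2) * (ψ x ^ 2 - (1 - k ^ 2)) := fun x =>
    dn_deriv_sq hψ hψ' hode hψ0 hψ'0 x ▸ sq_nonneg _
  have hlow : ∀ x, 1 - k ^ 2 ≤ ψ x ^ 2 := fun x => by
    by_contra! h
    nlinarith [hprod x, sq_pos_of_pos hk0]
  have hupp : ∀ x, ψ x ^ 2 ≤ 1 := fun x => by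
    by_contra! h
    nlinarith [hprod x, sq_pos_of_pos hk0]
  have hpos : ∀ x, 0 < ψ x := fun x => by
    by_contra! h
    obtain ⟨y, hy⟩ := mem_range_of_exists_le_of_exists_ge hψ.continuous ⟨x, h⟩
      ⟨0, hψ0.symm ▸ zero_le_one⟩
    have := hlow y
    rw [hy] at this
    linarith
  exact fun x => ⟨Real.sqrt_le_iff.2 ⟨(hpos x).le, hlow x⟩,
    (sq_le_one_iff₀ (hpos x).le).1 (hupp x)⟩
end

section
/- Let k ∈ (0,1) and L > 0 satisfy 9L⁴ > 2048 K(k)⁴ (1 − k² + k⁴), and define Δ, a, b, c, A by the explicit formulas below. Let ψ : ℝ → ℝ be twice differentiable with ψ'' = (2 − k²)ψ − 2ψ³, ψ(0) = 1, ψ'(0) = 0, and set φ(x) = a + b(ψ(2K(k)x/L)² − E(k)/K(k)). Then φ is twice differentiable and satisfies the traveling-wave equation (φ(x) − c)φ''(x) + φ'(x)²/2 − φ(x)³ + cφ(x) = A for all x ∈ ℝ. -/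
/-- The complete elliptic integral of the first kind. -/
noncomputable def ellipticK (k : ℝ) : ℝ :=
  ∫ θ in (0:ℝ)..(Real.pi / 2), 1 / Real.sqrt (1 - k ^ 2 * Real.sin θ ^ 2)

/-- The complete elliptic integral of the second kind. -/
noncomputable def ellipticE (k : ℝ) : ℝ :=
  ∫ θ in (0:ℝ)..(Real.pi / 2), Real.sqrt (1 - k ^ 2 * Real.sin θ ^ 2)

/-- The first integral of `ψ'' = p ψ - 2 ψ³` with `ψ 0 = 1`, `ψ' 0 = 0`. -/
lemma deriv_sq_eq_of_cubic_ode {p : ℝ} {ψ : ℝ → ℝ} (hψ : Differentiable ℝ ψ)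
    (hψ' : Differentiable ℝ (deriv ψ))
    (hode : ∀ x, deriv (deriv ψ) x = p * ψ x - 2 * ψ x ^ 3)
    (hψ0 : ψ 0 = 1) (hψ'0 : deriv ψ 0 = 0) (x : ℝ) :
    deriv ψ x ^ 2 = p * ψ x ^ 2 - ψ x ^ 4 - (p - 1) := by
  have hd : ∀ y, HasDerivAt (fun y => deriv ψ y ^ 2 - p * ψ y ^ 2 + ψ y ^ 4) 0 y := by
    intro y
    have h0 := (hψ y).hasDerivAt
    have h1 := (hψ' y).hasDerivAt
    rw [hode y] at h1
    refine (((h1.pow 2).sub ((h0.pow 2).const_mul p)).add (h0.pow 4)).congr_deriv ?_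
    push_cast
    ring
  have hconst := is_const_of_deriv_eq_zero (fun y => (hd y).differentiableAt)
    (fun y => (hd y).deriv) x 0
  simp only [hψ0, hψ'0] at hconst
  linear_combination hconst

/-- Rescaled form of the algebraic identity behind the traveling-wave equation, with
`κ = K² / L²`, `δ = Δ / L²`, `q = k²` and `u = ψ²`. -/
lemma traveling_wave_identity {κ δ q u : ℝ} (hδ : δ ^ 2 = 9 - 2048 * κ ^ 2 * (1 - q + q ^ 2)) :
    ((32 * (2 - q) * κ - 3 / 2 + δ / 2) / 3 - 32 * κ * u - (3 / 2 - δ / 2)) *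
        (-128 * κ ^ 2 * (4 * (2 - q) * u - 6 * u ^ 2 - 2 * (1 - q)))
      + 2 * (32 * κ) ^ 2 * (4 * κ) * u * ((2 - q) * u - u ^ 2 - (1 - q))
      - ((32 * (2 - q) * κ - 3 / 2 + δ / 2) / 3 - 32 * κ * u) ^ 3
      + (3 / 2 - δ / 2) * ((32 * (2 - q) * κ - 3 / 2 + δ / 2) / 3 - 32 * κ * u)
      = (1 / 27) * ((1280 * (-1 + q - q ^ 2) * κ ^ 2 + 9) * δ
          + (-16384 - 16384 * q ^ 3 + 24576 * q + 24576 * q ^ 2) * κ ^ 3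
          + 6912 * (1 - q + q ^ 2) * κ ^ 2 - 27) := by
  linear_combination
    (-δ / 216 - ((32 * (2 - q) * κ - 3 / 2) / 3 - 32 * κ * u) / 12 - 1 / 12) * hδ

theorem dnoidal_satisfies_traveling_wave (k L : ℝ) (hk : k ∈ Set.Ioo (0:ℝ) 1) (hL : 0 < L)
    (hcond : 9 * L ^ 4 > 2048 * (ellipticK k) ^ 4 * (1 - k ^ 2 + k ^ 4))
    (Δ a b c A : ℝ)
    (hΔ : Δ = Real.sqrt (9 * L ^ 4 - 2048 * (ellipticK k) ^ 4 * (1 - k ^ 2 + k ^ 4)))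
    (hb : b = -32 * (ellipticK k) ^ 2 / L ^ 2)
    (hc : c = ((3 / 2) * L ^ 2 - Δ / 2) / L ^ 2)
    (ha : a = -(1 / (3 * L ^ 2)) * (-32 * (2 - k ^ 2) * (ellipticK k) ^ 2
        + 96 * (ellipticE k) * (ellipticK k) + (3 / 2) * L ^ 2 - Δ / 2))
    (hA : A = (1 / (27 * L ^ 6)) *
        ((1280 * (-1 + k ^ 2 - k ^ 4) * (ellipticK k) ^ 4 + 9 * L ^ 4) * Δ
          + (-16384 - 16384 * k ^ 6 + 24576 * k ^ 2 + 24576 * k ^ 4) * (ellipticK k) ^ 6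
          + 6912 * L ^ 2 * (1 - k ^ 2 + k ^ 4) * (ellipticK k) ^ 4 - 27 * L ^ 6))
    (ψ : ℝ → ℝ) (hψ : Differentiable ℝ ψ) (hψ' : Differentiable ℝ (deriv ψ))
    (hode : ∀ x, deriv (deriv ψ) x = (2 - k ^ 2) * ψ x - 2 * (ψ x) ^ 3)
    (hψ0 : ψ 0 = 1) (hψ'0 : deriv ψ 0 = 0)
    (φ : ℝ → ℝ)
    (hφ : ∀ x, φ x = a + b * ((ψ (2 * ellipticK k * x / L)) ^ 2 - ellipticE k / ellipticK k)) :
    Differentiable ℝ φ ∧ Differentiable ℝ (deriv φ) ∧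
      ∀ x, (φ x - c) * deriv (deriv φ) x + (deriv φ x) ^ 2 / 2 - (φ x) ^ 3 + c * φ x = A := by
  have hL0 : L ≠ 0 := hL.ne'
  have hfirst := deriv_sq_eq_of_cubic_ode hψ hψ' hode hψ0 hψ'0
  have hΔ2 : Δ ^ 2 = 9 * L ^ 4 - 2048 * ellipticK k ^ 4 * (1 - k ^ 2 + k ^ 4) := by
    rw [hΔ, Real.sq_sqrt (by linarith)]
  have hEK : ellipticK k ^ 2 * (ellipticE k / ellipticK k) = ellipticE k * ellipticK k := by
    by_cases h : ellipticK k = 0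
    · simp [h]
    · field_simp
  generalize ellipticK k = K at *
  generalize ellipticE k = E at *
  have hlin : ∀ x, HasDerivAt (fun x => 2 * K * x / L) (2 * K / L) x := fun x => by
    simpa using ((hasDerivAt_id x).const_mul (2 * K)).div_const L
  have hφ1 : ∀ x, HasDerivAt φ
      (b * (2 * (ψ (2 * K * x / L) * deriv ψ (2 * K * x / L)) * (2 * K / L))) x := fun x => by
    have h0 := (hψ (2 * K * x / L)).hasDerivAt.comp x (hlin x)
    rw [funext hφ]
    refine ((((h0.pow 2).sub_const (E / K)).const_mul b).const_add a).congr_deriv ?_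
    simp only [Function.comp_apply]
    push_cast
    ring
  have hφ' : deriv φ = fun x =>
      b * (2 * (ψ (2 * K * x / L) * deriv ψ (2 * K * x / L)) * (2 * K / L)) :=
    funext fun x => (hφ1 x).deriv
  have hφ2 : ∀ x, HasDerivAt (deriv φ)
      (b * (2 * K / L) ^ 2 * (4 * (2 - k ^ 2) * ψ (2 * K * x / L) ^ 2
        - 6 * (ψ (2 * K * x / L) ^ 2) ^ 2 - 2 * (1 - k ^ 2))) x := fun x => by
    have h0 := (hψ (2 * K * x / L)).hasDerivAt.comp x (hlin x)
    have h1 := (hψ' (2 * K * x / L)).hasDerivAt.comp x (hlin x)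
    rw [hφ']
    refine ((((h0.mul h1).const_mul 2).mul_const (2 * K / L)).const_mul b).congr_deriv ?_
    simp only [Function.comp_apply]
    rw [hode]
    linear_combination 2 * b * (2 * K / L) ^ 2 * hfirst (2 * K * x / L)
  refine ⟨fun x => (hφ1 x).differentiableAt, fun x => (hφ2 x).differentiableAt, fun x => ?_⟩
  rw [(hφ2 x).deriv, (hφ1 x).deriv]
  have hf := hfirst (2 * K * x / L)
  have hφx := hφ x
  generalize ψ (2 * K * x / L) = s at *
  generalize deriv ψ (2 * K * x / L) = t at *
  have hval : φ x = (32 * (2 - k ^ 2) * (K ^ 2 / L ^ 2) - 3 / 2 + Δ / L ^ 2 / 2) / 3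
      - 32 * (K ^ 2 / L ^ 2) * s ^ 2 := by
    have h : b * (E / K) = -32 * (E * K) / L ^ 2 := by
      rw [hb, ← hEK]
      ring
    rw [hφx, mul_sub, h, ha, hb]
    field_simp
    ring
  have hδ : (Δ / L ^ 2) ^ 2
      = 9 - 2048 * (K ^ 2 / L ^ 2) ^ 2 * (1 - k ^ 2 + (k ^ 2) ^ 2) := by
    rw [div_pow, hΔ2]
    field_simp
  have hc' : c = 3 / 2 - Δ / L ^ 2 / 2 := by
    rw [hc]
    field_simp
  have hm : (2 * K / L) ^ 2 = 4 * (K ^ 2 / L ^ 2) := by ring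
  have hb' : b = -32 * (K ^ 2 / L ^ 2) := by
    rw [hb]
    ring
  have hsq : (b * (2 * (s * t) * (2 * K / L))) ^ 2 / 2
      = 2 * (32 * (K ^ 2 / L ^ 2)) ^ 2 * (4 * (K ^ 2 / L ^ 2)) * s ^ 2
        * ((2 - k ^ 2) * s ^ 2 - (s ^ 2) ^ 2 - (1 - k ^ 2)) := by
    rw [← hm, hb']
    linear_combination 2 * (32 * (K ^ 2 / L ^ 2)) ^ 2 * (2 * K / L) ^ 2 * s ^ 2 * hf
  have hA' : A = (1 / 27) * ((1280 * (-1 + k ^ 2 - (k ^ 2) ^ 2) * (K ^ 2 / L ^ 2) ^ 2 + 9)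
        * (Δ / L ^ 2)
      + (-16384 - 16384 * (k ^ 2) ^ 3 + 24576 * k ^ 2 + 24576 * (k ^ 2) ^ 2) * (K ^ 2 / L ^ 2) ^ 3
      + 6912 * (1 - k ^ 2 + (k ^ 2) ^ 2) * (K ^ 2 / L ^ 2) ^ 2 - 27) := by
    rw [hA]
    field_simp
  rw [hsq, hm, hval, hc', hA', hb', ← traveling_wave_identity (u := s ^ 2) hδ]
  ring
end

section
/- There exists L₀ > 0 such that for every L ≥ L₀ there exists k₁ ∈ (0,1) such that for all k ∈ (0,k₁): 9L⁴ > 2048 K(k)⁴ (1 − k² + k⁴), and the wave speed c = ((3/2)L² − (1/2)√(9L⁴ − 2048 K(k)⁴ (1 − k² + k⁴)))/L² satisfies the strict inequality c² − 3c + 32π⁴/L⁴ < 0. -/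
lemma quarter_le_ellipticK_radicand {k : ℝ} (hk : k ∈ Set.Ioo (0:ℝ) (1 / 2)) (θ : ℝ) :
    1 / 4 ≤ 1 - k ^ 2 * Real.sin θ ^ 2 := by
  obtain ⟨h0, h1⟩ := hk
  have hs := Real.sin_sq_le_one θ
  have hk2 : k ^ 2 ≤ 1 / 4 := by nlinarith
  nlinarith [mul_le_of_le_one_right (sq_nonneg k) hs]

lemma intervalIntegrable_ellipticK {k : ℝ} (hk : k ∈ Set.Ioo (0:ℝ) (1 / 2)) :
    IntervalIntegrable (fun θ => 1 / Real.sqrt (1 - k ^ 2 * Real.sin θ ^ 2))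
      MeasureTheory.volume 0 (Real.pi / 2) := by
  apply Continuous.intervalIntegrable
  refine continuous_const.div (by fun_prop) fun θ => ?_
  have h := quarter_le_ellipticK_radicand hk θ
  exact (Real.sqrt_pos.2 (by linarith)).ne'

lemma ellipticK_le_four {k : ℝ} (hk : k ∈ Set.Ioo (0:ℝ) (1 / 2)) : ellipticK k ≤ 4 := by
  have hle : ellipticK k ≤ ∫ _ in (0:ℝ)..(Real.pi / 2), (2:ℝ) := by
    refine intervalIntegral.integral_mono_on (by positivity) (intervalIntegrable_ellipticK hk)
      (by simp) fun θ _ => ?_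
    have h := quarter_le_ellipticK_radicand hk θ
    have hs : 1 / 2 ≤ Real.sqrt (1 - k ^ 2 * Real.sin θ ^ 2) :=
      Real.le_sqrt_of_sq_le (by linarith)
    rw [div_le_iff₀ (by linarith)]
    linarith
  rw [intervalIntegral.integral_const, smul_eq_mul] at hle
  linarith [Real.pi_le_four]

lemma one_add_half_le_one_div_sqrt {u : ℝ} (hu : 0 ≤ u) (hu1 : u < 1) :
    1 + u / 2 ≤ 1 / Real.sqrt (1 - u) := by
  have hpos : 0 < Real.sqrt (1 - u) := Real.sqrt_pos.2 (by linarith)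
  have hsq := Real.sq_sqrt (show 0 ≤ 1 - u by linarith)
  rw [le_div_iff₀ hpos]
  have h : Real.sqrt (1 - u) ≤ 1 - u / 2 := by
    rw [Real.sqrt_le_left (by linarith)]
    nlinarith [sq_nonneg u]
  nlinarith [sq_nonneg u]

lemma ellipticK_lower_bound {k : ℝ} (hk : k ∈ Set.Ioo (0:ℝ) (1 / 2)) :
    Real.pi / 2 * (1 + k ^ 2 / 4) ≤ ellipticK k := by
  have hint : ∫ θ in (0:ℝ)..(Real.pi / 2), (1 + k ^ 2 / 2 * Real.sin θ ^ 2)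
      = Real.pi / 2 * (1 + k ^ 2 / 4) := by
    rw [intervalIntegral.integral_add (by simp)
      (Continuous.intervalIntegrable (by fun_prop) _ _), intervalIntegral.integral_const_mul,
      integral_sin_sq, intervalIntegral.integral_const]
    simp
    ring
  rw [← hint]
  refine intervalIntegral.integral_mono_on (by positivity)
    (Continuous.intervalIntegrable (by fun_prop) _ _) (intervalIntegrable_ellipticK hk)
    fun θ _ => ?_
  have h := quarter_le_ellipticK_radicand hk θ
  have := one_add_half_le_one_div_sqrt (u := k ^ 2 * Real.sin θ ^ 2) (by positivity)
    (by linarith)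
  linarith

lemma pi_div_two_pow_four_lt_ellipticK {k : ℝ} (hk : k ∈ Set.Ioo (0:ℝ) (1 / 2)) :
    (Real.pi / 2) ^ 4 < ellipticK k ^ 4 * (1 - k ^ 2 + k ^ 4) := by
  have hx : 0 < k ^ 2 := pow_pos hk.1 2
  have hm : 0 < 1 - k ^ 2 + k ^ 4 := by nlinarith [sq_nonneg (k ^ 2 - 1 / 2)]
  have hpoly : 1 < (1 + k ^ 2 / 4) ^ 4 * (1 - k ^ 2 + k ^ 4) := by
    have hlow : 1 + k ^ 2 + 3 / 8 * (k ^ 2) ^ 2 ≤ (1 + k ^ 2 / 4) ^ 4 := by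
      have : 0 ≤ (k ^ 2) ^ 3 / 16 + (k ^ 2) ^ 4 / 256 := by positivity
      linarith
    have hexp : (1 + k ^ 2 + 3 / 8 * (k ^ 2) ^ 2) * (1 - k ^ 2 + k ^ 4)
        = 1 + (3 / 8 * (k ^ 2) ^ 2 + 5 / 8 * (k ^ 2) ^ 3 + 3 / 8 * (k ^ 2) ^ 4) := by ring
    have : 0 < 3 / 8 * (k ^ 2) ^ 2 + 5 / 8 * (k ^ 2) ^ 3 + 3 / 8 * (k ^ 2) ^ 4 := by positivity
    linarith [mul_le_mul_of_nonneg_right hlow hm.le]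
  calc (Real.pi / 2) ^ 4
      < (Real.pi / 2) ^ 4 * ((1 + k ^ 2 / 4) ^ 4 * (1 - k ^ 2 + k ^ 4)) :=
        lt_mul_of_one_lt_right (by positivity) hpoly
    _ = (Real.pi / 2 * (1 + k ^ 2 / 4)) ^ 4 * (1 - k ^ 2 + k ^ 4) := by ring
    _ ≤ ellipticK k ^ 4 * (1 - k ^ 2 + k ^ 4) := by
        gcongr
        exact ellipticK_lower_bound hk

theorem wave_speed_strict_inequality :
    ∃ L₀ > (0:ℝ), ∀ L ≥ L₀, ∃ k₁ ∈ Set.Ioo (0:ℝ) 1, ∀ k ∈ Set.Ioo (0:ℝ) k₁,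
      9 * L ^ 4 > 2048 * (ellipticK k) ^ 4 * (1 - k ^ 2 + k ^ 4) ∧
      (((3 / 2) * L ^ 2 - (1 / 2) * Real.sqrt (9 * L ^ 4
          - 2048 * (ellipticK k) ^ 4 * (1 - k ^ 2 + k ^ 4))) / L ^ 2) ^ 2
        - 3 * (((3 / 2) * L ^ 2 - (1 / 2) * Real.sqrt (9 * L ^ 4
          - 2048 * (ellipticK k) ^ 4 * (1 - k ^ 2 + k ^ 4))) / L ^ 2)
        + 32 * Real.pi ^ 4 / L ^ 4 < 0 := by
  refine ⟨100, by norm_num, fun L hL => ⟨1 / 2, by norm_num, fun k hk => ?_⟩⟩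
  have hK0 : 0 ≤ ellipticK k := le_trans (by positivity) (ellipticK_lower_bound hk)
  have hK4 : ellipticK k ^ 4 ≤ 4 ^ 4 := pow_le_pow_left₀ hK0 (ellipticK_le_four hk) 4
  have hm1 : 1 - k ^ 2 + k ^ 4 ≤ 1 := by
    have hk2 : k ^ 2 ≤ 1 := by nlinarith [hk.1, hk.2]
    nlinarith [mul_nonneg (sq_nonneg k) (sub_nonneg.2 hk2)]
  have hL4 : (100:ℝ) ^ 4 ≤ L ^ 4 := pow_le_pow_left₀ (by norm_num) hL 4
  have hL0 : 0 < L := by linarith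
  have hlt : 2048 * ellipticK k ^ 4 * (1 - k ^ 2 + k ^ 4) < 9 * L ^ 4 := by
    have := mul_le_of_le_one_right (show 0 ≤ 2048 * ellipticK k ^ 4 by positivity) hm1
    linarith
  refine ⟨hlt, ?_⟩
  have hsq := Real.sq_sqrt (sub_nonneg.2 hlt.le)
  set s := Real.sqrt (9 * L ^ 4 - 2048 * ellipticK k ^ 4 * (1 - k ^ 2 + k ^ 4))
  have hc : (((3 / 2) * L ^ 2 - (1 / 2) * s) / L ^ 2) ^ 2
      - 3 * (((3 / 2) * L ^ 2 - (1 / 2) * s) / L ^ 2) + 32 * Real.pi ^ 4 / L ^ 4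
      = (s ^ 2 - 9 * L ^ 4 + 128 * Real.pi ^ 4) / (4 * L ^ 4) := by
    field_simp
    ring
  rw [hc, hsq]
  apply div_neg_of_neg_of_pos _ (by positivity)
  linarith [pi_div_two_pow_four_lt_ellipticK hk]
end

section
/- Let L > 0 and let u : ℝ × ℝ → ℝ, (x,t) ↦ u(x,t), be infinitely differentiable, spatially L-periodic, and satisfy u_t − u_txx = u u_xxx + 2u_x u_xx − 3u² u_x on ℝ × ℝ. Then the function t ↦ (1/2)∫₀^L (u(x,t)² + u_x(x,t)²) dx is constant in t. -/
/-- Partial derivative with respect to the first (spatial) variable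
of a function `u x t`. -/
noncomputable def pderivX (u : ℝ → ℝ → ℝ) : ℝ → ℝ → ℝ :=
  fun x t => deriv (fun y => u y t) x

/-- Partial derivative with respect to the second (temporal) variable
of a function `u x t`. -/
noncomputable def pderivT (u : ℝ → ℝ → ℝ) : ℝ → ℝ → ℝ :=
  fun x t => deriv (fun s => u x s) t

section PartialDerivatives

variable {f : ℝ → ℝ → ℝ}

theorem hasDerivAt_left_fderiv (hf : Differentiable ℝ (fun p : ℝ × ℝ => f p.1 p.2)) (x t : ℝ) :
    HasDerivAt (fun y => f y t) (fderiv ℝ (fun p : ℝ × ℝ => f p.1 p.2) (x, t) (1, 0)) x :=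
  HasFDerivAt.comp_hasDerivAt (l := fun p : ℝ × ℝ => f p.1 p.2) (f := fun y : ℝ => (y, t))
    x (hf (x, t)).hasFDerivAt ((hasDerivAt_id' x).prodMk (hasDerivAt_const x t))

theorem pderivX_eq_fderiv (hf : Differentiable ℝ (fun p : ℝ × ℝ => f p.1 p.2)) (x t : ℝ) :
    pderivX f x t = fderiv ℝ (fun p : ℝ × ℝ => f p.1 p.2) (x, t) (1, 0) :=
  (hasDerivAt_left_fderiv hf x t).deriv

theorem hasDerivAt_pderivX (hf : Differentiable ℝ (fun p : ℝ × ℝ => f p.1 p.2)) (x t : ℝ) :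
    HasDerivAt (fun y => f y t) (pderivX f x t) x :=
  (hasDerivAt_left_fderiv hf x t).differentiableAt.hasDerivAt

theorem hasDerivAt_right_fderiv (hf : Differentiable ℝ (fun p : ℝ × ℝ => f p.1 p.2)) (x t : ℝ) :
    HasDerivAt (fun s => f x s) (fderiv ℝ (fun p : ℝ × ℝ => f p.1 p.2) (x, t) (0, 1)) t :=
  HasFDerivAt.comp_hasDerivAt (l := fun p : ℝ × ℝ => f p.1 p.2) (f := fun s : ℝ => (x, s))
    t (hf (x, t)).hasFDerivAt ((hasDerivAt_const t x).prodMk (hasDerivAt_id' t))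

theorem pderivT_eq_fderiv (hf : Differentiable ℝ (fun p : ℝ × ℝ => f p.1 p.2)) (x t : ℝ) :
    pderivT f x t = fderiv ℝ (fun p : ℝ × ℝ => f p.1 p.2) (x, t) (0, 1) :=
  (hasDerivAt_right_fderiv hf x t).deriv

theorem hasDerivAt_pderivT (hf : Differentiable ℝ (fun p : ℝ × ℝ => f p.1 p.2)) (x t : ℝ) :
    HasDerivAt (fun s => f x s) (pderivT f x t) t :=
  (hasDerivAt_right_fderiv hf x t).differentiableAt.hasDerivAt

theorem contDiff_pderivX {m n : WithTop ℕ∞} (hf : ContDiff ℝ n (fun p : ℝ × ℝ => f p.1 p.2))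
    (hmn : m + 1 ≤ n) : ContDiff ℝ m (fun p : ℝ × ℝ => pderivX f p.1 p.2) := by
  have hd : Differentiable ℝ (fun p : ℝ × ℝ => f p.1 p.2) :=
    (hf.of_le (le_add_self.trans hmn)).differentiable one_ne_zero
  simp_rw [pderivX_eq_fderiv hd]
  exact (hf.fderiv_right hmn).clm_apply contDiff_const

theorem contDiff_pderivT {m n : WithTop ℕ∞} (hf : ContDiff ℝ n (fun p : ℝ × ℝ => f p.1 p.2))
    (hmn : m + 1 ≤ n) : ContDiff ℝ m (fun p : ℝ × ℝ => pderivT f p.1 p.2) := by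
  have hd : Differentiable ℝ (fun p : ℝ × ℝ => f p.1 p.2) :=
    (hf.of_le (le_add_self.trans hmn)).differentiable one_ne_zero
  simp_rw [pderivT_eq_fderiv hd]
  exact (hf.fderiv_right hmn).clm_apply contDiff_const

theorem pderivT_pderivX_comm (hf : ContDiff ℝ 2 (fun p : ℝ × ℝ => f p.1 p.2)) (x t : ℝ) :
    pderivT (pderivX f) x t = pderivX (pderivT f) x t := by
  have hd := hf.differentiable two_ne_zero
  have h11 : (1 : WithTop ℕ∞) + 1 ≤ 2 := one_add_one_eq_two.le
  have hX := (contDiff_pderivX hf h11).differentiable one_ne_zero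
  have hT := (contDiff_pderivT hf h11).differentiable one_ne_zero
  have hdd := (hf.fderiv_right h11).differentiable one_ne_zero (x, t)
  have hsymm := hf.contDiffAt.isSymmSndFDerivAt (x := (x, t)) (by simp)
  rw [pderivT_eq_fderiv hX, pderivX_eq_fderiv hT]
  simp_rw [pderivX_eq_fderiv hd, pderivT_eq_fderiv hd]
  rw [fderiv_clm_apply hdd (by fun_prop), fderiv_clm_apply hdd (by fun_prop)]
  simpa using hsymm (0, 1) (1, 0)

theorem pderivX_periodic {L : ℝ} (hper : ∀ x t, f (x + L) t = f x t) (x t : ℝ) :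
    pderivX f (x + L) t = pderivX f x t := by
  unfold pderivX
  rw [← deriv_comp_add_const]
  simp_rw [hper]

theorem pderivT_periodic {L : ℝ} (hper : ∀ x t, f (x + L) t = f x t) (x t : ℝ) :
    pderivT f (x + L) t = pderivT f x t := by
  simp_rw [pderivT, hper]

end PartialDerivatives

/-- A density whose time derivative is the spatial derivative of a periodic flux has a conserved
integral over one period. -/
theorem integral_eq_of_hasDerivAt_flux {L : ℝ} {g h G : ℝ → ℝ → ℝ}
    (hcont : Continuous (fun p : ℝ × ℝ => h p.1 p.2))
    (hg : ∀ x t, HasDerivAt (fun s => g x s) (h x t) t)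
    (hG : ∀ x t, HasDerivAt (fun y => G y t) (h x t) x)
    (hgcont : ∀ t, Continuous fun x => g x t)
    (hper : ∀ t, G L t = G 0 t) (t₁ t₂ : ℝ) :
    ∫ x in (0:ℝ)..L, g x t₁ = ∫ x in (0:ℝ)..L, g x t₂ := by
  have hx : ∀ x, ∫ t in t₁..t₂, h x t = g x t₂ - g x t₁ := fun x =>
    intervalIntegral.integral_eq_sub_of_hasDerivAt (fun t _ => hg x t)
      (Continuous.intervalIntegrable (by fun_prop) _ _)
  have ht : ∀ t, ∫ x in (0:ℝ)..L, h x t = 0 := fun t => by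
    rw [intervalIntegral.integral_eq_sub_of_hasDerivAt (fun x _ => hG x t)
      (Continuous.intervalIntegrable (by fun_prop) _ _), hper, sub_self]
  have hswap : ∫ x in (0:ℝ)..L, ∫ t in t₁..t₂, h x t = ∫ t in t₁..t₂, ∫ x in (0:ℝ)..L, h x t :=
    MeasureTheory.intervalIntegral_intervalIntegral_swap
      ((hcont.continuousOn.integrableOn_compact (isCompact_uIcc.prod isCompact_uIcc)).mono_set
        (Set.prod_mono Set.uIoc_subset_uIcc Set.uIoc_subset_uIcc))
  simp_rw [hx, ht] at hswap
  rw [intervalIntegral.integral_sub ((hgcont _).intervalIntegrable _ _)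
    ((hgcont _).intervalIntegrable _ _), intervalIntegral.integral_zero] at hswap
  linarith

theorem mCH_conservation_F (L : ℝ) (hL : 0 < L) (u : ℝ → ℝ → ℝ)
    (hsmooth : ContDiff ℝ (⊤ : ℕ∞) (fun p : ℝ × ℝ => u p.1 p.2))
    (hper : ∀ x t, u (x + L) t = u x t)
    (hpde : ∀ x t, pderivT u x t - pderivX (pderivX (pderivT u)) x t
        = u x t * pderivX (pderivX (pderivX u)) x t
          + 2 * pderivX u x t * pderivX (pderivX u) x t
          - 3 * (u x t) ^ 2 * pderivX u x t) :
    ∀ t₁ t₂ : ℝ,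
      (1 / 2) * ∫ x in (0:ℝ)..L, ((u x t₁) ^ 2 + (pderivX u x t₁) ^ 2)
        = (1 / 2) * ∫ x in (0:ℝ)..L, ((u x t₂) ^ 2 + (pderivX u x t₂) ^ 2) := by
  intro t₁ t₂
  have htop : ((⊤ : ℕ∞) : WithTop ℕ∞) + 1 ≤ ((⊤ : ℕ∞) : WithTop ℕ∞) := le_rfl
  have hne : ((⊤ : ℕ∞) : WithTop ℕ∞) ≠ 0 := by simp
  have hX := contDiff_pderivX hsmooth htop
  have hXX := contDiff_pderivX hX htop
  have hT := contDiff_pderivT hsmooth htop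
  have hTX := contDiff_pderivX hT htop
  have hcu := hsmooth.continuous
  have hcX := hX.continuous
  have hcT := hT.continuous
  have hcTX := hTX.continuous
  congr 1
  refine integral_eq_of_hasDerivAt_flux (g := fun x t => u x t ^ 2 + pderivX u x t ^ 2)
    (h := fun x t => 2 * (u x t * pderivT u x t + pderivX u x t * pderivX (pderivT u) x t))
    (G := fun x t => 2 * (u x t * pderivX (pderivT u) x t
      + u x t ^ 2 * pderivX (pderivX u) x t - 3 / 4 * u x t ^ 4))
    (by fun_prop) (fun x t => ?_) (fun x t => ?_) (fun t => ?_) (fun t => ?_) t₁ t₂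
  · have hcomm := pderivT_pderivX_comm (contDiff_infty.1 hsmooth 2) x t
    have h₁ := hasDerivAt_pderivT (hsmooth.differentiable hne) x t
    have h₂ := hasDerivAt_pderivT (hX.differentiable hne) x t
    rw [hcomm] at h₂
    refine ((h₁.pow 2).add (h₂.pow 2)).congr_deriv ?_
    ring
  · have h₁ := hasDerivAt_pderivX (hsmooth.differentiable hne) x t
    have h₂ := hasDerivAt_pderivX (hTX.differentiable hne) x t
    have h₃ := hasDerivAt_pderivX (hXX.differentiable hne) x t
    refine ((((h₁.mul h₂).add ((h₁.pow 2).mul h₃)).sub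
      ((h₁.pow 4).const_mul (3 / 4))).const_mul 2).congr_deriv ?_
    simp only [Pi.pow_apply]
    linear_combination (-2 * u x t) * hpde x t
  · exact ((hcu.comp (by fun_prop : Continuous fun x : ℝ => (x, t))).pow 2).add
      ((hcX.comp (by fun_prop : Continuous fun x : ℝ => (x, t))).pow 2)
  · have h₁ := hper 0 t
    have h₂ := pderivX_periodic (pderivT_periodic hper) 0 t
    have h₃ := pderivX_periodic (pderivX_periodic hper) 0 t
    rw [zero_add] at h₁ h₂ h₃
    simp only [h₁, h₂, h₃]
end

section
/- Let L > 0, c, A ∈ ℝ, and let φ : ℝ → ℝ be a smooth L-periodic solution of (φ − c)φ'' + (φ')²/2 − φ³ + cφ = A. Then for every smooth L-periodic function v : ℝ → ℝ, the second derivative at s = 0 of s ↦ G(φ + sv) equals the quadratic form of the linearized operator: (d²/ds²) G(φ + sv)|_{s=0} = ∫₀^L [ (φ(x) − c)v''(x) + φ'(x)v'(x) + (c − 3φ(x)² + φ''(x))v(x) ] v(x) dx. -/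
open intervalIntegral in
theorem integral_quartic {f₀ f₁ f₂ f₃ f₄ : ℝ → ℝ} (h₀ : Continuous f₀) (h₁ : Continuous f₁)
    (h₂ : Continuous f₂) (h₃ : Continuous f₃) (h₄ : Continuous f₄) (a b s : ℝ) :
    ∫ x in a..b, (f₀ x + s * f₁ x + s ^ 2 * f₂ x + s ^ 3 * f₃ x + s ^ 4 * f₄ x)
      = (∫ x in a..b, f₀ x) + s * (∫ x in a..b, f₁ x) + s ^ 2 * (∫ x in a..b, f₂ x)
        + s ^ 3 * (∫ x in a..b, f₃ x) + s ^ 4 * (∫ x in a..b, f₄ x) := by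
  rw [integral_add, integral_add, integral_add, integral_add]
  · simp only [integral_const_mul]
  all_goals exact Continuous.intervalIntegrable (by fun_prop) _ _

theorem deriv_deriv_quartic_zero (a₀ a₁ a₂ a₃ a₄ : ℝ) :
    deriv (deriv fun s : ℝ => a₀ + s * a₁ + s ^ 2 * a₂ + s ^ 3 * a₃ + s ^ 4 * a₄) 0
      = 2 * a₂ := by
  have h : (deriv fun s : ℝ => a₀ + s * a₁ + s ^ 2 * a₂ + s ^ 3 * a₃ + s ^ 4 * a₄)
      = fun s => a₁ + 2 * s * a₂ + 3 * s ^ 2 * a₃ + 4 * s ^ 3 * a₄ := by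
    funext s
    have := (((((hasDerivAt_id s).mul_const a₁).const_add a₀).add
      (((hasDerivAt_id s).pow 2).mul_const a₂)).add
      (((hasDerivAt_id s).pow 3).mul_const a₃)).add (((hasDerivAt_id s).pow 4).mul_const a₄)
    refine (this.congr_deriv ?_).deriv
    simp
  rw [h]
  have := (((((hasDerivAt_id (0 : ℝ)).const_mul 2).mul_const a₂).const_add a₁).add
    ((((hasDerivAt_id (0 : ℝ)).pow 2).const_mul 3).mul_const a₃)).add
    ((((hasDerivAt_id (0 : ℝ)).pow 3).const_mul 4).mul_const a₄)
  refine (this.congr_deriv ?_).deriv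
  simp

theorem deriv_add_period {f : ℝ → ℝ} {L : ℝ} (hf : ∀ x, f (x + L) = f x) (x : ℝ) :
    deriv f (x + L) = deriv f x := by
  rw [← deriv_comp_add_const]
  simp only [hf]

/-- The quadratic form of the linearized operator after integration by parts. -/
theorem integral_linearized_mul_self {L : ℝ} (c : ℝ) {φ v : ℝ → ℝ}
    (hφ : ContDiff ℝ 2 φ) (hφper : ∀ x, φ (x + L) = φ x)
    (hv : ContDiff ℝ 2 v) (hvper : ∀ x, v (x + L) = v x) :
    ∫ x in (0:ℝ)..L, ((φ x - c) * deriv (deriv v) x + deriv φ x * deriv v x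
        + (c - 3 * (φ x) ^ 2 + deriv (deriv φ) x) * v x) * v x
      = ∫ x in (0:ℝ)..L, ((c - 3 * φ x ^ 2) * v x ^ 2 + (c - φ x) * deriv v x ^ 2
          - 2 * deriv φ x * v x * deriv v x) := by
  have hφ' : ContDiff ℝ 1 (deriv φ) := hφ.deriv'
  have hv' : ContDiff ℝ 1 (deriv v) := hv.deriv'
  have cφ := hφ.continuous
  have cv := hv.continuous
  have cφ' := hφ'.continuous
  have cv' := hv'.continuous
  have cφ'' : Continuous (deriv (deriv φ)) := hφ'.continuous_deriv le_rfl
  have cv'' : Continuous (deriv (deriv v)) := hv'.continuous_deriv le_rfl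
  rw [← sub_eq_zero, ← intervalIntegral.integral_sub
    (Continuous.intervalIntegrable (by fun_prop) _ _)
    (Continuous.intervalIntegrable (by fun_prop) _ _)]
  have key := intervalIntegral.integral_eq_sub_of_hasDerivAt (a := 0) (b := L)
    (f := fun x => (φ x - c) * v x * deriv v x + deriv φ x * v x ^ 2)
    (f' := fun x => ((φ x - c) * deriv (deriv v) x + deriv φ x * deriv v x
        + (c - 3 * (φ x) ^ 2 + deriv (deriv φ) x) * v x) * v x
      - ((c - 3 * φ x ^ 2) * v x ^ 2 + (c - φ x) * deriv v x ^ 2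
          - 2 * deriv φ x * v x * deriv v x))
    (fun x _ => by
      have d₁ := (hφ.differentiable (by norm_num) x).hasDerivAt
      have d₂ := (hv.differentiable (by norm_num) x).hasDerivAt
      have d₃ := (hφ'.differentiable (by norm_num) x).hasDerivAt
      have d₄ := (hv'.differentiable (by norm_num) x).hasDerivAt
      refine ((((d₁.sub_const c).mul d₂).mul d₄).add (d₃.mul (d₂.pow 2))).congr_deriv ?_
      simp
      ring)
    (Continuous.intervalIntegrable (by fun_prop) _ _)
  rw [key]
  have e₁ := hφper 0
  have e₂ := hvper 0
  have e₃ := deriv_add_period hφper 0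
  have e₄ := deriv_add_period hvper 0
  rw [zero_add] at e₁ e₂ e₃ e₄
  simp only [e₁, e₂, e₃, e₄, sub_self]


theorem traveling_wave_second_variation (L c A : ℝ) (hL : 0 < L)
    (φ : ℝ → ℝ) (hφ : ContDiff ℝ (⊤ : ℕ∞) φ) (hφper : ∀ x, φ (x + L) = φ x)
    (hode : ∀ x, (φ x - c) * deriv (deriv φ) x + (deriv φ x) ^ 2 / 2
        - (φ x) ^ 3 + c * φ x = A) :
    ∀ v : ℝ → ℝ, ContDiff ℝ (⊤ : ℕ∞) v → (∀ x, v (x + L) = v x) →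
      deriv (deriv (fun s : ℝ =>
        -(∫ x in (0:ℝ)..L, ((φ x + s * v x) ^ 4 / 4
            + (φ x + s * v x) * (deriv φ x + s * deriv v x) ^ 2 / 2))
        + (c / 2) * (∫ x in (0:ℝ)..L, ((φ x + s * v x) ^ 2
            + (deriv φ x + s * deriv v x) ^ 2))
        - A * (∫ x in (0:ℝ)..L, (φ x + s * v x)))) 0
      = ∫ x in (0:ℝ)..L,
          ((φ x - c) * deriv (deriv v) x + deriv φ x * deriv v x
            + (c - 3 * (φ x) ^ 2 + deriv (deriv φ) x) * v x) * v x := by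
  intro v hv hvper
  have hφ₂ : ContDiff ℝ 2 φ := mod_cast contDiff_infty.1 hφ 2
  have hv₂ : ContDiff ℝ 2 v := mod_cast contDiff_infty.1 hv 2
  rw [integral_linearized_mul_self c hφ₂ hφper hv₂ hvper]
  have cφ := hφ₂.continuous
  have cv := hv₂.continuous
  have cφ' : Continuous (deriv φ) := hφ₂.continuous_deriv (by norm_num)
  have cv' : Continuous (deriv v) := hv₂.continuous_deriv (by norm_num)
  have expand : (fun s : ℝ =>
        -(∫ x in (0:ℝ)..L, ((φ x + s * v x) ^ 4 / 4
            + (φ x + s * v x) * (deriv φ x + s * deriv v x) ^ 2 / 2))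
        + (c / 2) * (∫ x in (0:ℝ)..L, ((φ x + s * v x) ^ 2
            + (deriv φ x + s * deriv v x) ^ 2))
        - A * (∫ x in (0:ℝ)..L, (φ x + s * v x)))
      = fun s : ℝ =>
        (∫ x in (0:ℝ)..L, (-(φ x ^ 4 / 4 + φ x * deriv φ x ^ 2 / 2)
          + c / 2 * (φ x ^ 2 + deriv φ x ^ 2) - A * φ x))
        + s * (∫ x in (0:ℝ)..L, (-(φ x ^ 3 * v x + v x * deriv φ x ^ 2 / 2
            + φ x * deriv φ x * deriv v x)
          + c * (φ x * v x + deriv φ x * deriv v x) - A * v x))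
        + s ^ 2 * (∫ x in (0:ℝ)..L, (1 / 2) * ((c - 3 * φ x ^ 2) * v x ^ 2
          + (c - φ x) * deriv v x ^ 2 - 2 * deriv φ x * v x * deriv v x))
        + s ^ 3 * (∫ x in (0:ℝ)..L, -(φ x * v x ^ 3 + v x * deriv v x ^ 2 / 2))
        + s ^ 4 * (∫ x in (0:ℝ)..L, -(v x ^ 4 / 4)) := by
    funext s
    rw [← integral_quartic (by fun_prop) (by fun_prop) (by fun_prop) (by fun_prop) (by fun_prop),
      ← intervalIntegral.integral_neg, ← intervalIntegral.integral_const_mul,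
      ← intervalIntegral.integral_const_mul, ← intervalIntegral.integral_add
        (Continuous.intervalIntegrable (by fun_prop) _ _)
        (Continuous.intervalIntegrable (by fun_prop) _ _),
      ← intervalIntegral.integral_sub
        (Continuous.intervalIntegrable (by fun_prop) _ _)
        (Continuous.intervalIntegrable (by fun_prop) _ _)]
    congr 1
    funext x
    ring
  rw [expand, deriv_deriv_quartic_zero, intervalIntegral.integral_const_mul]
  ring
end

section
/- Let H be a real Hilbert space and T : H → H a bounded self-adjoint operator. Assume: (i) there exist χ ∈ H with ‖χ‖ = 1 and μ > 0 such that Tχ = −μχ; (ii) there is a nonzero w₀ ∈ H with Tw₀ = 0; (iii) there is δ > 0 such that ⟨Tv, v⟩ ≥ δ‖v‖² for all v with ⟨v, χ⟩ = 0 and ⟨v, w₀⟩ = 0. Let q ∈ H be nonzero with ⟨q, w₀⟩ = 0 and set Υ₀ = {u ∈ H : ⟨q, u⟩ = 0}. Suppose there exists Φ ∈ H with ⟨TΦ, u⟩ = 0 for all u ∈ Υ₀ and ⟨TΦ, Φ⟩ < 0 (Vakhitov–Kolokolov condition). Then there exists C > 0 such that ⟨Tv, v⟩ ≥ C‖v‖²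 for all v ∈ Υ₀ with ⟨v, w₀⟩ = 0. -/
open scoped RealInnerProductSpace

/-- Cauchy–Schwarz inequality for a symmetric operator that is nonnegative on the plane spanned by
two vectors. -/
theorem sq_inner_map_le_of_nonneg {H : Type*} [NormedAddCommGroup H] [InnerProductSpace ℝ H]
    (T : H →L[ℝ] H) (hT : ∀ x y : H, ⟪T x, y⟫ = ⟪x, T y⟫) (p r : H)
    (hnn : ∀ t : ℝ, 0 ≤ ⟪T (t • p + r), t • p + r⟫) :
    ⟪T p, r⟫ ^ 2 ≤ ⟪T p, p⟫ * ⟪T r, r⟫ := by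
  have hsymm : ⟪T r, p⟫ = ⟪T p, r⟫ := by rw [hT, real_inner_comm]
  have h : ∀ t : ℝ, 0 ≤ ⟪T p, p⟫ * (t * t) + (2 * ⟪T p, r⟫) * t + ⟪T r, r⟫ := fun t => by
    have := hnn t
    simp only [map_add, map_smul, inner_add_left, inner_add_right, real_inner_smul_left,
      real_inner_smul_right, hsymm] at this
    linarith
  have := discrim_le_zero h
  unfold discrim at this
  linarith

/-- The form `-μ b² + R` is coercive when `(b, R)` is constrained by a Cauchy–Schwarz inequality
against a negative direction `(a, P)`. -/
theorem coercive_of_sq_le {μ δ a P b R n : ℝ} (hμ : 0 < μ) (hδ : 0 < δ) (hP : 0 ≤ P)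
    (hneg : P < μ * a ^ 2) (hR : δ * n ≤ R) (hR₀ : 0 ≤ R) (hCS : (μ * a * b) ^ 2 ≤ P * R) :
    (μ * a ^ 2 - P) / (μ * a ^ 2) / (1 / μ + 1 / δ) * (b ^ 2 + n) ≤ -μ * b ^ 2 + R := by
  have hA : 0 < μ * a ^ 2 := by linarith
  have hb : μ * a ^ 2 * (μ * b ^ 2) ≤ P * R := by linarith
  have hbR : μ * b ^ 2 ≤ R := by
    refine le_of_mul_le_mul_left (hb.trans ?_) hA
    gcongr
  have hsum : b ^ 2 + n ≤ R * (1 / μ + 1 / δ) := by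
    have h₁ : b ^ 2 ≤ R / μ := by rw [le_div_iff₀ hμ]; linarith
    have h₂ : n ≤ R / δ := by rw [le_div_iff₀ hδ]; linarith
    calc b ^ 2 + n ≤ R / μ + R / δ := add_le_add h₁ h₂
      _ = R * (1 / μ + 1 / δ) := by ring
  have hK : 0 < 1 / μ + 1 / δ := by positivity
  have hθ : 0 < (μ * a ^ 2 - P) / (μ * a ^ 2) := div_pos (by linarith) hA
  calc (μ * a ^ 2 - P) / (μ * a ^ 2) / (1 / μ + 1 / δ) * (b ^ 2 + n)
      ≤ (μ * a ^ 2 - P) / (μ * a ^ 2) / (1 / μ + 1 / δ) * (R * (1 / μ + 1 / δ)) := by gcongr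
    _ = (μ * a ^ 2 - P) * R / (μ * a ^ 2) := by
        generalize 1 / μ + 1 / δ = K at hK
        field_simp
    _ ≤ -μ * b ^ 2 + R := by
        rw [div_le_iff₀ hA]
        linarith

theorem abstract_coercivity {H : Type*} [NormedAddCommGroup H] [InnerProductSpace ℝ H]
    [CompleteSpace H] (T : H →L[ℝ] H) (hT : ∀ x y : H, ⟪T x, y⟫ = ⟪x, T y⟫)
    (χ : H) (hχ : ‖χ‖ = 1) (μ : ℝ) (hμ : 0 < μ) (hTχ : T χ = -μ • χ)
    (w₀ : H) (hw₀ : w₀ ≠ 0) (hTw₀ : T w₀ = 0)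
    (δ : ℝ) (hδ : 0 < δ)
    (hpos : ∀ v : H, ⟪v, χ⟫ = 0 → ⟪v, w₀⟫ = 0 → ⟪T v, v⟫ ≥ δ * ‖v‖ ^ 2)
    (q : H) (hq : q ≠ 0) (hqw₀ : ⟪q, w₀⟫ = 0)
    (Φ : H) (hΦ : ∀ u : H, ⟪q, u⟫ = 0 → ⟪T Φ, u⟫ = 0)
    (hVK : ⟪T Φ, Φ⟫ < 0) :
    ∃ C > (0:ℝ), ∀ v : H, ⟪q, v⟫ = 0 → ⟪v, w₀⟫ = 0 → ⟪T v, v⟫ ≥ C * ‖v‖ ^ 2 := by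
  have hχχ : ⟪χ, χ⟫ = 1 := by rw [real_inner_self_eq_norm_sq, hχ, one_pow]
  have hχw : ⟪χ, w₀⟫ = 0 := by
    have h := hT χ w₀
    rw [hTχ, hTw₀, inner_zero_right, real_inner_smul_left] at h
    exact (mul_eq_zero.mp h).resolve_left (by linarith)
  have hwχ : ⟪w₀, χ⟫ = 0 := by rw [real_inner_comm, hχw]
  have hww : ⟪w₀, w₀⟫ ≠ 0 := inner_self_ne_zero.mpr hw₀
  obtain ⟨a, c, p, hΦp, hpχ, hpw⟩ : ∃ (a c : ℝ) (p : H),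
      Φ = a • χ + p + c • w₀ ∧ ⟪p, χ⟫ = 0 ∧ ⟪p, w₀⟫ = 0 := by
    refine ⟨⟪Φ, χ⟫, ⟪Φ, w₀⟫ / ⟪w₀, w₀⟫,
      Φ - ⟪Φ, χ⟫ • χ - (⟪Φ, w₀⟫ / ⟪w₀, w₀⟫) • w₀, by abel, ?_, ?_⟩
    · simp only [inner_sub_left, real_inner_smul_left, hχχ, hwχ]
      ring
    · simp only [inner_sub_left, real_inner_smul_left, hχw]
      rw [div_mul_cancel₀ _ hww]
      ring
  have hχp : ⟪χ, p⟫ = 0 := by rw [real_inner_comm, hpχ]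
  have hTperp : ∀ x : H, ⟪x, χ⟫ = 0 → ⟪T x, χ⟫ = 0 := fun x hx => by
    rw [hT, hTχ, real_inner_smul_right, hx, mul_zero]
  have hTw : ∀ x : H, ⟪T x, w₀⟫ = 0 := fun x => by rw [hT, hTw₀, inner_zero_right]
  have hTΦ : T Φ = (-(μ * a)) • χ + T p := by
    rw [hΦp, map_add, map_add, map_smul, map_smul, hTχ, hTw₀, smul_zero, add_zero, smul_smul]
    congr 2
    ring
  have hneg : ⟪T p, p⟫ < μ * a ^ 2 := by
    have h : ⟪T Φ, Φ⟫ = -(μ * a ^ 2) + ⟪T p, p⟫ := by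
      rw [hTΦ, hΦp]
      simp only [inner_add_left, inner_add_right, real_inner_smul_left, real_inner_smul_right,
        hχχ, hχw, hχp, hTperp p hpχ, hTw]
      ring
    linarith
  have hnn : ∀ x : H, ⟪x, χ⟫ = 0 → ⟪x, w₀⟫ = 0 → 0 ≤ ⟪T x, x⟫ := fun x h₁ h₂ =>
    le_trans (by positivity) (hpos x h₁ h₂)
  have hP := hnn p hpχ hpw
  have hA : 0 < μ * a ^ 2 := by linarith
  refine ⟨(μ * a ^ 2 - ⟪T p, p⟫) / (μ * a ^ 2) / (1 / μ + 1 / δ),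
    div_pos (div_pos (by linarith) hA) (by positivity), fun v hqv hvw => ?_⟩
  obtain ⟨b, r, rfl, hrχ⟩ : ∃ (b : ℝ) (r : H), v = b • χ + r ∧ ⟪r, χ⟫ = 0 := by
    refine ⟨⟪v, χ⟫, v - ⟪v, χ⟫ • χ, by abel, ?_⟩
    rw [inner_sub_left, real_inner_smul_left, hχχ, mul_one, sub_self]
  have hχr : ⟪χ, r⟫ = 0 := by rw [real_inner_comm, hrχ]
  have hrw : ⟪r, w₀⟫ = 0 := by
    simpa only [inner_add_left, real_inner_smul_left, hχw, mul_zero, zero_add] using hvw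
  have hpr : ⟪T p, r⟫ = μ * a * b := by
    have h := hΦ _ hqv
    rw [hTΦ] at h
    simp only [inner_add_left, inner_add_right, real_inner_smul_left, real_inner_smul_right,
      hχχ, hχr, hTperp p hpχ] at h
    linarith
  have hCS := sq_inner_map_le_of_nonneg T hT p r fun t => hnn _
    (by rw [inner_add_left, real_inner_smul_left, hpχ, hrχ, mul_zero, add_zero])
    (by rw [inner_add_left, real_inner_smul_left, hpw, hrw, mul_zero, add_zero])
  rw [hpr] at hCS
  have hnorm : ‖b • χ + r‖ ^ 2 = b ^ 2 + ‖r‖ ^ 2 := by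
    simp only [← real_inner_self_eq_norm_sq, inner_add_left, inner_add_right,
      real_inner_smul_left, real_inner_smul_right, hχχ, hχr, hrχ]
    ring
  have hform : ⟪T (b • χ + r), b • χ + r⟫ = -μ * b ^ 2 + ⟪T r, r⟫ := by
    simp only [map_add, map_smul, hTχ, inner_add_left, inner_add_right,
      real_inner_smul_left, real_inner_smul_right, hχχ, hχr, hTperp r hrχ]
    ring
  rw [hnorm, hform]
  exact coercive_of_sq_le hμ hδ hP hneg (hpos r hrχ hrw) (hnn r hrχ hrw) hCS
end

section
/- Let H be a real Hilbert space, T : H → H a bounded self-adjoint operator, and q, w₀ ∈ H with q ≠ 0 and ⟨q, w₀⟩ = 0. Assume there exists C > 0 such that ⟨Tz, z⟩ ≥ C‖z‖² for all z ∈ H with ⟨q, z⟩ = 0 and ⟨z, w₀⟩ = 0. Then there exist N > 0 and τ > 0 such that ⟨Tv, v⟩ + 2N⟨q, v⟩² ≥ τ‖v‖² for all v ∈ H with ⟨v, w₀⟩ = 0. -/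
open scoped RealInnerProductSpace

theorem augmented_coercivity {H : Type*} [NormedAddCommGroup H] [InnerProductSpace ℝ H]
    [CompleteSpace H] (T : H →L[ℝ] H) (hT : ∀ x y : H, ⟪T x, y⟫ = ⟪x, T y⟫)
    (q w₀ : H) (hq : q ≠ 0) (hqw₀ : ⟪q, w₀⟫ = 0)
    (C : ℝ) (hC : 0 < C)
    (hpos : ∀ z : H, ⟪q, z⟫ = 0 → ⟪z, w₀⟫ = 0 → ⟪T z, z⟫ ≥ C * ‖z‖ ^ 2) :
    ∃ N > (0:ℝ), ∃ τ > (0:ℝ), ∀ v : H, ⟪v, w₀⟫ = 0 →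
      ⟪T v, v⟫ + 2 * N * ⟪q, v⟫ ^ 2 ≥ τ * ‖v‖ ^ 2 := by
  have hn : 0 < ‖q‖ := norm_pos_iff.mpr hq
  refine ⟨(‖T q‖ * ‖q‖ + 2 * ‖T q‖ ^ 2 / C + C / 2 * ‖q‖ ^ 2) / (2 * ‖q‖ ^ 4), by positivity,
    C / 2, by positivity, fun v hv => ?_⟩
  obtain ⟨a, z, rfl, hqz⟩ : ∃ (a : ℝ) (z : H), v = a • q + z ∧ ⟪q, z⟫ = 0 := by
    refine ⟨⟪q, v⟫ / ‖q‖ ^ 2, v - (⟪q, v⟫ / ‖q‖ ^ 2) • q, by abel, ?_⟩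
    rw [inner_sub_right, real_inner_smul_right, real_inner_self_eq_norm_sq]
    field_simp
    ring
  have hzw : ⟪z, w₀⟫ = 0 := by
    simpa [inner_add_left, real_inner_smul_left, hqw₀] using hv
  have hz := hpos z hqz hzw
  have hqv : ⟪q, a • q + z⟫ = a * ‖q‖ ^ 2 := by
    rw [inner_add_right, real_inner_smul_right, real_inner_self_eq_norm_sq, hqz, add_zero]
  have hnorm : ‖a • q + z‖ ^ 2 = a ^ 2 * ‖q‖ ^ 2 + ‖z‖ ^ 2 := by
    rw [norm_add_sq_real, real_inner_smul_left, hqz, norm_smul, mul_pow, Real.norm_eq_abs, sq_abs]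
    ring
  have hTv : ⟪T (a • q + z), a • q + z⟫ =
      a ^ 2 * ⟪T q, q⟫ + 2 * (a * ⟪T q, z⟫) + ⟪T z, z⟫ := by
    have hsymm : ⟪T z, q⟫ = ⟪T q, z⟫ := by rw [hT, real_inner_comm]
    simp only [map_add, map_smul, inner_add_left, inner_add_right, real_inner_smul_left,
      real_inner_smul_right, hsymm]
    ring
  have hqq : -(‖T q‖ * ‖q‖) ≤ ⟪T q, q⟫ := (abs_le.mp (abs_real_inner_le_norm (T q) q)).1
  have hdiag := mul_le_mul_of_nonneg_left hqq (sq_nonneg a)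
  have hcross : -(|a| * (‖T q‖ * ‖z‖)) ≤ a * ⟪T q, z⟫ := by
    refine (abs_le.mp ?_).1
    rw [abs_mul]
    exact mul_le_mul_of_nonneg_left (abs_real_inner_le_norm _ _) (abs_nonneg a)
  have hyoung : 2 * (|a| * (‖T q‖ * ‖z‖)) ≤
      C / 2 * ‖z‖ ^ 2 + a ^ 2 * (2 * ‖T q‖ ^ 2 / C) := by
    have hsq : C / 2 * ‖z‖ ^ 2 + a ^ 2 * (2 * ‖T q‖ ^ 2 / C) - 2 * (|a| * (‖T q‖ * ‖z‖)) =
        (C * ‖z‖ - 2 * (|a| * ‖T q‖)) ^ 2 / (2 * C) := by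
      rw [← sq_abs a]
      field_simp
      ring
    have : 0 ≤ (C * ‖z‖ - 2 * (|a| * ‖T q‖)) ^ 2 / (2 * C) := by positivity
    linarith
  have hN : 2 * ((‖T q‖ * ‖q‖ + 2 * ‖T q‖ ^ 2 / C + C / 2 * ‖q‖ ^ 2) / (2 * ‖q‖ ^ 4)) *
      (a * ‖q‖ ^ 2) ^ 2 =
      a ^ 2 * (‖T q‖ * ‖q‖) + a ^ 2 * (2 * ‖T q‖ ^ 2 / C) + C / 2 * (a ^ 2 * ‖q‖ ^ 2) := by
    field_simp
  rw [hqv, hnorm, hTv, hN]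
  linarith
end

section
/- Let X be a real Hilbert space, φ, w₀ ∈ X, and B : X → ℝ twice continuously differentiable on a neighborhood of φ. Assume B(φ) = 0, the Fréchet derivative of B at φ is zero, and there exists τ > 0 such that the second Fréchet derivative satisfies D²B(φ)[v, v] ≥ τ‖v‖² for all v ∈ X with ⟨v, w₀⟩ = 0. Then there exist α > 0 and D > 0 such that B(u) ≥ D‖u − φ‖² for every u ∈ X with ‖u − φ‖ < α and ⟨u − φ, w₀⟩ = 0. -/
open scoped RealInnerProductSpace

/-- Second-order Taylor estimate at a critical point. -/
theorem ContDiffAt.exists_abs_sub_half_fderiv_fderiv_le {E : Type*} [NormedAddCommGroup E]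
    [NormedSpace ℝ E] {f : E → ℝ} {a : E} (hf : ContDiffAt ℝ 2 f a) (hf' : fderiv ℝ f a = 0)
    {ε : ℝ} (hε : 0 < ε) :
    ∃ δ > 0, ∀ x : E, ‖x - a‖ < δ →
      |f x - f a - fderiv ℝ (fderiv ℝ f) a (x - a) (x - a) / 2| ≤ ε * ‖x - a‖ ^ 2 := by
  have hdiff : ∀ᶠ x in nhds a, DifferentiableAt ℝ f x :=
    (hf.eventually (by simp)).mono fun x hx => hx.differentiableAt (by norm_num)
  have hderiv : HasFDerivAt (fderiv ℝ f) (fderiv ℝ (fderiv ℝ f) a) a :=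
    ((hf.fderiv_right (m := 1) (by norm_num)).differentiableAt (by norm_num)).hasFDerivAt
  obtain ⟨δ, hδ, hball⟩ := Metric.eventually_nhds_iff.1
    (hdiff.and (hderiv.isLittleO.def hε))
  refine ⟨δ, hδ, fun x hx => ?_⟩
  set v := x - a with hv
  set A := fderiv ℝ (fderiv ℝ f) a
  have hseg : ∀ t ∈ Set.Icc (0 : ℝ) 1, Dist.dist (a + t • v) a < δ := fun t ht => by
    rw [dist_eq_norm, add_sub_cancel_left, norm_smul, Real.norm_of_nonneg ht.1]
    exact (mul_le_of_le_one_left (norm_nonneg v) ht.2).trans_lt hx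
  have hline : ∀ t ∈ Set.Icc (0 : ℝ) 1, HasDerivAt
      (fun t : ℝ => f (a + t • v) - t ^ 2 * (A v v / 2))
      (fderiv ℝ f (a + t • v) v - t * A v v) t := fun t ht => by
    have h₁ : HasDerivAt (fun t : ℝ => a + t • v) v t := by
      simpa using ((hasDerivAt_id t).smul_const v).const_add a
    have h₂ := (hball (hseg t ht)).1.hasFDerivAt.comp_hasDerivAt t h₁
    have h₃ := h₂.sub ((hasDerivAt_pow 2 t).mul_const (A v v / 2))
    refine h₃.congr_deriv ?_
    push_cast
    ring
  obtain ⟨t, ht, hslope⟩ := exists_hasDerivAt_eq_slope _ _ zero_lt_one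
    (fun t ht => (hline t ht).continuousAt.continuousWithinAt)
    (fun t ht => hline t (Set.Ioo_subset_Icc_self ht))
  have hbound := (hball (hseg t (Set.Ioo_subset_Icc_self ht))).2
  rw [hf', sub_zero, add_sub_cancel_left, norm_smul, Real.norm_of_nonneg ht.1.le] at hbound
  have happ := ContinuousLinearMap.le_of_opNorm_le _ hbound v
  have hx' : a + v = x := by simp [hv]
  simp only [one_smul, zero_smul, add_zero, hx'] at hslope
  have heq : f x - f a - A v v / 2 = (fderiv ℝ f (a + t • v) - A (t • v)) v := by
    simp only [map_smul, sub_apply, smul_apply, smul_eq_mul]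
    linarith
  rw [heq, ← Real.norm_eq_abs]
  refine happ.trans ?_
  rw [mul_assoc, mul_assoc, ← sq]
  exact mul_le_mul_of_nonneg_left (mul_le_of_le_one_left (sq_nonneg _) ht.2.le) hε.le

theorem lyapunov_quadratic_lower_bound {X : Type*} [NormedAddCommGroup X]
    [InnerProductSpace ℝ X] [CompleteSpace X]
    (φ w₀ : X) (B : X → ℝ) (hB : ContDiffAt ℝ 2 B φ)
    (hBφ : B φ = 0) (hB'φ : fderiv ℝ B φ = 0)
    (τ : ℝ) (hτ : 0 < τ)
    (hB'' : ∀ v : X, ⟪v, w₀⟫ = 0 → fderiv ℝ (fderiv ℝ B) φ v v ≥ τ * ‖v‖ ^ 2) :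
    ∃ α > (0:ℝ), ∃ D > (0:ℝ), ∀ u : X, ‖u - φ‖ < α → ⟪u - φ, w₀⟫ = 0 →
      B u ≥ D * ‖u - φ‖ ^ 2 := by
  have hτ4 : 0 < τ / 4 := by positivity
  obtain ⟨α, hα, h⟩ := hB.exists_abs_sub_half_fderiv_fderiv_le hB'φ hτ4
  refine ⟨α, hα, τ / 4, hτ4, fun u hu horth => ?_⟩
  have h₁ := (abs_le.1 (h u hu)).1
  have h₂ := hB'' _ horth
  linarith
end

section
/- Let H be a real Hilbert space, I ⊆ ℝ an open interval, and E, F, V : H → ℝ functionals whose gradient maps ∇E, ∇F, ∇V : H → H (the Riesz representatives of the Fréchet derivatives) exist and are differentiable. Let φ : I → H and c, A : I → ℝ be differentiable and suppose ∇E(φ(k)) + c(k)∇F(φ(k)) − A(k)∇V(φ(k)) = 0 for all k ∈ I. Fix k ∈ I, set Φ = φ'(k), and let 𝓛 : H → H be the Fréchet derivative of the map u ↦ ∇E(u) + c(k)∇F(u) − A(k)∇V(u) at φ(k). Then ⟨𝓛Φ, Φ⟩ = A'(k) · (d/dk)V(φ(k)) − c'(k) · (d/dk)F(φ(k)). -/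
open scoped RealInnerProductSpace

/-- Chain rule for a functional with a gradient along a differentiable curve. -/
theorem HasGradientAt.comp_hasDerivAt_real {H : Type*} [NormedAddCommGroup H]
    [InnerProductSpace ℝ H] [CompleteSpace H] {W : H → ℝ} {g : H} {γ : ℝ → H} {γ' : H} {t : ℝ}
    (hW : HasGradientAt W g (γ t)) (hγ : HasDerivAt γ γ' t) :
    HasDerivAt (fun s => W (γ s)) ⟪g, γ'⟫ t := by
  simpa [Function.comp_def] using hW.hasFDerivAt.comp_hasDerivAt t hγ

/-- Differentiating `P (γ t) + c t • Q (γ t) - A t • R (γ t) = 0` along the curve `γ`. -/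
theorem fderiv_add_smul_sub_smul_apply_of_eventually_eq_zero {X Y : Type*}
    [NormedAddCommGroup X] [NormedSpace ℝ X] [NormedAddCommGroup Y] [NormedSpace ℝ Y]
    {P Q R : X → Y} {γ : ℝ → X} {γ' : X} {c A : ℝ → ℝ} {c' A' k : ℝ}
    (hP : DifferentiableAt ℝ P (γ k)) (hQ : DifferentiableAt ℝ Q (γ k))
    (hR : DifferentiableAt ℝ R (γ k)) (hγ : HasDerivAt γ γ' k)
    (hc : HasDerivAt c c' k) (hA : HasDerivAt A A' k)
    (h : ∀ᶠ t in nhds k, P (γ t) + c t • Q (γ t) - A t • R (γ t) = 0) :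
    fderiv ℝ (fun u => P u + c k • Q u - A k • R u) (γ k) γ' =
      A' • R (γ k) - c' • Q (γ k) := by
  have hPγ := hP.hasFDerivAt.comp_hasDerivAt k hγ
  have hQγ := hQ.hasFDerivAt.comp_hasDerivAt k hγ
  have hRγ := hR.hasFDerivAt.comp_hasDerivAt k hγ
  have hzero := ((hPγ.add (hc.smul hQγ)).sub (hA.smul hRγ)).unique
    ((hasDerivAt_const k (0 : Y)).congr_of_eventuallyEq h)
  have hL : HasFDerivAt (fun u => P u + c k • Q u - A k • R u)
      (fderiv ℝ P (γ k) + c k • fderiv ℝ Q (γ k) - A k • fderiv ℝ R (γ k)) (γ k) :=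
    (hP.hasFDerivAt.add (hQ.hasFDerivAt.const_smul (c k))).sub
      (hR.hasFDerivAt.const_smul (A k))
  rw [hL.fderiv]
  simp only [Function.comp_apply] at hzero
  simp only [sub_apply, add_apply,
    smul_apply]
  rw [← sub_eq_zero, ← hzero]
  abel

theorem vakhitov_kolokolov_identity {H : Type*} [NormedAddCommGroup H]
    [InnerProductSpace ℝ H] [CompleteSpace H]
    (x₁ x₂ : ℝ) (E F V : H → ℝ) (gE gF gV : H → H)
    (hgE : ∀ u : H, HasGradientAt E (gE u) u)
    (hgF : ∀ u : H, HasGradientAt F (gF u) u)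
    (hgV : ∀ u : H, HasGradientAt V (gV u) u)
    (hdE : Differentiable ℝ gE) (hdF : Differentiable ℝ gF) (hdV : Differentiable ℝ gV)
    (φ : ℝ → H) (c A : ℝ → ℝ)
    (hφ : ∀ t ∈ Set.Ioo x₁ x₂, DifferentiableAt ℝ φ t)
    (hc : ∀ t ∈ Set.Ioo x₁ x₂, DifferentiableAt ℝ c t)
    (hA : ∀ t ∈ Set.Ioo x₁ x₂, DifferentiableAt ℝ A t)
    (heq : ∀ t ∈ Set.Ioo x₁ x₂, gE (φ t) + c t • gF (φ t) - A t • gV (φ t) = 0)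
    (k : ℝ) (hk : k ∈ Set.Ioo x₁ x₂)
    (Φ : H) (hΦ : Φ = deriv φ k)
    (𝓛 : H →L[ℝ] H)
    (h𝓛 : 𝓛 = fderiv ℝ (fun u : H => gE u + c k • gF u - A k • gV u) (φ k)) :
    ⟪𝓛 Φ, Φ⟫ = deriv A k * deriv (fun t => V (φ t)) k
      - deriv c k * deriv (fun t => F (φ t)) k := by
  have hφk := (hφ k hk).hasDerivAt
  have hLΦ := fderiv_add_smul_sub_smul_apply_of_eventually_eq_zero (hdE (φ k)) (hdF (φ k))
    (hdV (φ k)) hφk (hc k hk).hasDerivAt (hA k hk).hasDerivAt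
    (Filter.eventually_of_mem (isOpen_Ioo.mem_nhds hk) heq)
  rw [h𝓛, hΦ, hLΦ, ((hgV (φ k)).comp_hasDerivAt_real hφk).deriv,
    ((hgF (φ k)).comp_hasDerivAt_real hφk).deriv, inner_sub_left, real_inner_smul_left,
    real_inner_smul_left]
end
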